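/- For every u > 0, the limit as t → 0+ of t·∫₀^u ∫₀^u ρ_t^{(2)}(v₁,v₂) dv₁ dv₂ equals u²/π. -/

import Mathlib

open Real MeasureTheory Filter

/-- The two-point density of the Pfaffian point process formed at time `t` by the
clusters of the Arratia flow. -/
noncomputable def rho2 (t v₁ v₂ : ℝ) : ℝ :=
  (1 / (π * t))
    * (1 + (|v₂ - v₁| / (2 * Real.sqrt t)) * Real.exp (-(v₂ - v₁) ^ 2 / (4 * t))
            * (∫ v in Set.Ioi (|v₂ - v₁| / Real.sqrt t), Real.exp (-v ^ 2 / 4))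
         - Real.exp (-(v₂ - v₁) ^ 2 / (2 * t)))

/-- The profile of the two-point density as a function of the rescaled distance. -/
noncomputable def rhoProfile (y : ℝ) : ℝ :=
  1 + y / 2 * Real.exp (-y ^ 2 / 4) * (∫ v in Set.Ioi y, Real.exp (-v ^ 2 / 4))
    - Real.exp (-y ^ 2 / 2)

theorem integrable_exp_neg_sq_div_four : Integrable fun v : ℝ => Real.exp (-v ^ 2 / 4) := by
  convert integrable_exp_neg_mul_sq (b := 1 / 4) (by norm_num) using 3
  ring

theorem gaussianTail_nonneg (y : ℝ) : 0 ≤ ∫ v in Set.Ioi y, Real.exp (-v ^ 2 / 4) :=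
  integral_nonneg fun _ => (Real.exp_pos _).le

theorem gaussianTail_le (y : ℝ) :
    ∫ v in Set.Ioi y, Real.exp (-v ^ 2 / 4) ≤ ∫ v : ℝ, Real.exp (-v ^ 2 / 4) :=
  setIntegral_le_integral integrable_exp_neg_sq_div_four
    (ae_of_all _ fun _ => (Real.exp_pos _).le)

theorem antitone_gaussianTail :
    Antitone fun y : ℝ => ∫ v in Set.Ioi y, Real.exp (-v ^ 2 / 4) := fun _ _ hab =>
  setIntegral_mono_set integrable_exp_neg_sq_div_four.integrableOn
    (ae_of_all _ fun _ => (Real.exp_pos _).le) (Set.Ioi_subset_Ioi hab).eventuallyLE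

theorem measurable_rhoProfile : Measurable rhoProfile := by
  have h := antitone_gaussianTail.measurable
  unfold rhoProfile
  fun_prop

theorem mul_exp_neg_sq_div_four_le_one (y : ℝ) : y / 2 * Real.exp (-y ^ 2 / 4) ≤ 1 := by
  have h := Real.add_one_le_exp (y ^ 2 / 4)
  rw [neg_div, Real.exp_neg, ← div_eq_mul_inv, div_le_one (Real.exp_pos _)]
  nlinarith [sq_nonneg (y - 1)]

theorem norm_rhoProfile_le {y : ℝ} (hy : 0 ≤ y) :
    ‖rhoProfile y‖ ≤ 1 + ∫ v : ℝ, Real.exp (-v ^ 2 / 4) := by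
  have h1 : Real.exp (-y ^ 2 / 2) ≤ 1 := Real.exp_le_one_iff.2 (by nlinarith [sq_nonneg y])
  have h2 : 0 < Real.exp (-y ^ 2 / 2) := Real.exp_pos _
  have h3 : 0 ≤ y / 2 * Real.exp (-y ^ 2 / 4) := by positivity
  have h4 := mul_nonneg h3 (gaussianTail_nonneg y)
  have h5 := mul_le_mul (mul_exp_neg_sq_div_four_le_one y) (gaussianTail_le y)
    (gaussianTail_nonneg y) zero_le_one
  rw [Real.norm_eq_abs, rhoProfile, abs_le]
  constructor <;> linarith

theorem tendsto_rhoProfile_atTop : Tendsto rhoProfile atTop (nhds 1) := by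
  have hsq : Tendsto (fun y : ℝ => Real.exp (-y ^ 2 / 2)) atTop (nhds 0) := by
    refine Real.tendsto_exp_atBot.comp ?_
    have h : Tendsto (fun y : ℝ => y ^ 2 / 2) atTop atTop :=
      (tendsto_pow_atTop two_ne_zero).atTop_div_const two_pos
    simpa only [neg_div, Function.comp_def] using tendsto_neg_atTop_atBot.comp h
  have hlin : Tendsto (fun y : ℝ => y / 2 * Real.exp (-y ^ 2 / 4)) atTop (nhds 0) := by
    have h : Tendsto (fun y : ℝ => y * Real.exp (-y)) atTop (nhds 0) := by
      simpa using Real.tendsto_pow_mul_exp_neg_atTop_nhds_zero 1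
    refine squeeze_zero' ?_ ?_ h
    · filter_upwards [eventually_ge_atTop 0] with y hy
      positivity
    · filter_upwards [eventually_ge_atTop 4] with y hy
      gcongr
      · linarith
      · nlinarith
  have htail : Tendsto (fun y : ℝ => y / 2 * Real.exp (-y ^ 2 / 4)
      * ∫ v in Set.Ioi y, Real.exp (-v ^ 2 / 4)) atTop (nhds 0) := by
    refine squeeze_zero' ?_ ?_
      (by simpa using hlin.mul_const (∫ v : ℝ, Real.exp (-v ^ 2 / 4)))
    · filter_upwards [eventually_ge_atTop 0] with y hy
      exact mul_nonneg (by positivity) (gaussianTail_nonneg y)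
    · filter_upwards [eventually_ge_atTop 0] with y hy
      exact mul_le_mul_of_nonneg_left (gaussianTail_le y) (by positivity)
  have h := (tendsto_const_nhds (x := (1 : ℝ)).add htail).sub hsq
  rwa [add_zero, sub_zero] at h

theorem mul_rho2_eq {t : ℝ} (ht : 0 < t) (v₁ v₂ : ℝ) :
    t * rho2 t v₁ v₂ = 1 / π * rhoProfile (|v₂ - v₁| / √t) := by
  have h (c : ℝ) : -(|v₂ - v₁| / √t) ^ 2 / c = -(v₂ - v₁) ^ 2 / (c * t) := by
    rw [div_pow, Real.sq_sqrt ht.le, sq_abs, neg_div, neg_div, div_div, mul_comm]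
  rw [rho2, rhoProfile, h, h, div_div, mul_comm (√t) 2, ← mul_assoc]
  congr 1
  field_simp

theorem norm_integral_rhoProfile_le {u : ℝ} (hu : 0 < u) (s x : ℝ) (hs : 0 ≤ s) :
    ‖∫ v in (0:ℝ)..u, rhoProfile (|x - v| / s)‖
      ≤ (1 + ∫ v : ℝ, Real.exp (-v ^ 2 / 4)) * u := by
  simpa [abs_of_pos hu] using intervalIntegral.norm_integral_le_of_norm_le_const
    (a := 0) (b := u) (f := fun v => rhoProfile (|x - v| / s))
    fun v _ => norm_rhoProfile_le (div_nonneg (abs_nonneg (x - v)) hs)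

theorem tendsto_integral_rhoProfile (u x : ℝ) :
    Tendsto (fun t : ℝ => ∫ v in (0:ℝ)..u, rhoProfile (|x - v| / √t))
      (nhdsWithin 0 (Set.Ioi 0)) (nhds u) := by
  have hsqrt : Tendsto (fun t : ℝ => (√t)⁻¹) (nhdsWithin 0 (Set.Ioi 0)) atTop := by
    refine tendsto_inv_nhdsGT_zero.comp (tendsto_nhdsWithin_iff.2 ⟨?_, ?_⟩)
    · simpa using (Real.continuous_sqrt.tendsto 0).mono_left nhdsWithin_le_nhds
    · filter_upwards [self_mem_nhdsWithin] with t ht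
      exact Real.sqrt_pos.2 ht
  have h := intervalIntegral.tendsto_integral_filter_of_dominated_convergence
    (μ := volume) (a := 0) (b := u) (l := nhdsWithin (0:ℝ) (Set.Ioi 0))
    (F := fun t v => rhoProfile (|x - v| / √t)) (f := fun _ => (1:ℝ))
    (fun _ => 1 + ∫ v : ℝ, Real.exp (-v ^ 2 / 4)) ?_ ?_ ?_ ?_
  · simpa using h
  · refine Eventually.of_forall fun t => Measurable.aestronglyMeasurable ?_
    exact measurable_rhoProfile.comp (by fun_prop)
  · exact Eventually.of_forall fun t => ae_of_all _ fun v _ =>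
      norm_rhoProfile_le (by positivity)
  · exact intervalIntegrable_const
  · filter_upwards [Measure.ae_ne volume x] with v hv _
    refine tendsto_rhoProfile_atTop.comp ?_
    simpa only [div_eq_mul_inv] using
      hsqrt.const_mul_atTop (abs_pos.2 (sub_ne_zero.2 hv.symm))

theorem measurable_integral_rhoProfile {u : ℝ} (hu : 0 < u) (s : ℝ) :
    StronglyMeasurable fun x : ℝ => ∫ v in (0:ℝ)..u, rhoProfile (|x - v| / s) := by
  simp only [intervalIntegral.integral_of_le hu.le]
  have h : Measurable fun p : ℝ × ℝ => rhoProfile (|p.1 - p.2| / s) :=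
    measurable_rhoProfile.comp (by fun_prop)
  exact h.stronglyMeasurable.integral_prod_right'

/-- Small-time asymptotics of the second factorial moment:
`t · ∫₀^u ∫₀^u ρ_t^{(2)}(v₁,v₂) dv₁ dv₂ → u²/π` as `t → 0+`. -/
theorem second_factorial_moment_small_time (u : ℝ) (hu : 0 < u) :
    Tendsto (fun t : ℝ => t * ∫ v₂ in (0:ℝ)..u, ∫ v₁ in (0:ℝ)..u, rho2 t v₁ v₂)
      (nhdsWithin 0 (Set.Ioi 0)) (nhds (u ^ 2 / π)) := by
  have h := intervalIntegral.tendsto_integral_filter_of_dominated_convergence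
    (μ := volume) (a := 0) (b := u) (l := nhdsWithin (0:ℝ) (Set.Ioi 0))
    (F := fun t x => ∫ v in (0:ℝ)..u, rhoProfile (|x - v| / √t)) (f := fun _ => u)
    (fun _ => (1 + ∫ v : ℝ, Real.exp (-v ^ 2 / 4)) * u)
    (Eventually.of_forall fun t => (measurable_integral_rhoProfile hu √t).aestronglyMeasurable)
    (Eventually.of_forall fun t => ae_of_all _ fun x _ =>
      norm_integral_rhoProfile_le hu _ x (Real.sqrt_nonneg t))
    intervalIntegrable_const
    (ae_of_all _ fun x _ => tendsto_integral_rhoProfile u x)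
  have hlim : 1 / π * ∫ _ in (0:ℝ)..u, u = u ^ 2 / π := by
    simp only [intervalIntegral.integral_const, sub_zero, smul_eq_mul]
    ring
  rw [← hlim]
  refine (h.const_mul (1 / π)).congr' ?_
  filter_upwards [self_mem_nhdsWithin] with t ht
  simp only [← intervalIntegral.integral_const_mul, mul_rho2_eq (Set.mem_Ioi.1 ht)]
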